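/- arXiv:2512.00858 — 4 statements merged into one kernel-verified Lean document; each statement's English description precedes it below -/
import Mathlib

section
/- Let b be a real number such that b is not a nonpositive integer and 2b − 1 is not a nonpositive integer. Then for every natural number n, ∑_{k=0}^{n} 1/(k! · (b)_k · (n−k)! · (b)_{n−k}) = 2^{2n} · (b − 1/2)_n / (n! · (b)_n · (2b − 1)_n). -/
open Polynomial Finset

/-- If `a k = (k + 1) (b + k) a (k + 1)`, then the Cauchy square of `a` satisfies a first-order
recurrence. The sum telescopes with certificate `k (b + k - 1) (2k - 2b - 1 - 3n) a_k a_{n+1-k}`. -/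
theorem cauchy_square_recurrence {R : Type*} [CommRing R] (b : R) (a : ℕ → R)
    (ha : ∀ k : ℕ, ((k : R) + 1) * (b + k) * a (k + 1) = a k) (n : ℕ) :
    ((n : R) + 1) * (b + n) * (2 * b - 1 + n) * ∑ k ∈ range (n + 2), a k * a (n + 1 - k) =
      (4 * b - 2 + 4 * n) * ∑ k ∈ range (n + 1), a k * a (n - k) := by
  let G : ℕ → R := fun k =>
    k * (b + k - 1) * (2 * k - 2 * b - 1 - 3 * n) * (a k * a (n + 1 - k))
  have telescope : ∑ k ∈ range (n + 1),
      (((n : R) + 1) * (b + n) * (2 * b - 1 + n) * (a k * a (n + 1 - k)) -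
        (4 * b - 2 + 4 * n) * (a k * a (n - k))) = G (n + 1) - G 0 := by
    rw [← sum_range_sub]
    refine sum_congr rfl fun k hk => ?_
    obtain ⟨m, rfl⟩ := Nat.exists_eq_add_of_le (Nat.lt_succ_iff.mp (mem_range.mp hk))
    have h₁ : k + m + 1 - k = m + 1 := by omega
    have h₂ : k + m - k = m := by omega
    have h₃ : k + m + 1 - (k + 1) = m := by omega
    simp only [G, h₁, h₂, h₃]
    push_cast
    rw [← ha m]
    linear_combination (-(2 * (k + 1) - 2 * b - 1 - 3 * (k + m)) *
      (((m : R) + 1) * (b + m) * a (m + 1))) * ha k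
  rw [sum_sub_distrib, ← mul_sum, ← mul_sum] at telescope
  rw [sum_range_succ _ (n + 1)]
  simp only [G, Nat.sub_self] at telescope ⊢
  push_cast at telescope
  linear_combination telescope

theorem ascPochhammer_eval_ne_zero {K : Type*} [Field K] {b : K}
    (hb : ∀ m : ℕ, b ≠ -(m : K)) (n : ℕ) : (ascPochhammer K n).eval b ≠ 0 := by
  induction n with
  | zero => simp
  | succ n ih =>
    rw [ascPochhammer_succ_eval]
    exact mul_ne_zero ih fun h => hb n (eq_neg_of_add_eq_zero_left h)

/-- For real `b` with `b` and `2b − 1` not nonpositive integers, and every natural `n`,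
`∑_{k=0}^{n} 1/(k! (b)_k (n−k)! (b)_{n−k}) = 2^{2n} (b − 1/2)_n / (n! (b)_n (2b − 1)_n)`. -/
theorem pochhammer_cauchy_identity (b : ℝ)
    (hb : ∀ m : ℕ, b ≠ -(m : ℝ)) (hb2 : ∀ m : ℕ, 2 * b - 1 ≠ -(m : ℝ)) (n : ℕ) :
    ∑ k ∈ Finset.range (n + 1),
        1 / ((k.factorial : ℝ) * (ascPochhammer ℝ k).eval b *
          ((n - k).factorial : ℝ) * (ascPochhammer ℝ (n - k)).eval b) =
      2 ^ (2 * n) * (ascPochhammer ℝ n).eval (b - 1 / 2) /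
        ((n.factorial : ℝ) * (ascPochhammer ℝ n).eval b *
          (ascPochhammer ℝ n).eval (2 * b - 1)) := by
  let a : ℕ → ℝ := fun k => 1 / ((k.factorial : ℝ) * (ascPochhammer ℝ k).eval b)
  have hbn (k : ℕ) : b + k ≠ 0 := fun h => hb k (eq_neg_of_add_eq_zero_left h)
  have hb2n (k : ℕ) : 2 * b - 1 + k ≠ 0 := fun h => hb2 k (eq_neg_of_add_eq_zero_left h)
  have ha (k : ℕ) : ((k : ℝ) + 1) * (b + k) * a (k + 1) = a k := by
    have h₁ := ascPochhammer_eval_ne_zero hb k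
    have h₂ := hbn k
    simp only [a, Nat.factorial_succ, ascPochhammer_succ_eval]
    push_cast
    field_simp
  have hsum (n : ℕ) : ∑ k ∈ Finset.range (n + 1),
        1 / ((k.factorial : ℝ) * (ascPochhammer ℝ k).eval b *
          ((n - k).factorial : ℝ) * (ascPochhammer ℝ (n - k)).eval b) =
      ∑ k ∈ range (n + 1), a k * a (n - k) :=
    sum_congr rfl fun k _ => by simp only [a, one_div_mul_one_div, mul_assoc]
  rw [hsum]
  induction n with
  | zero => simp [a]
  | succ n ih =>
    have h := cauchy_square_recurrence b a ha n
    have h₁ := ascPochhammer_eval_ne_zero hb n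
    have h₂ := ascPochhammer_eval_ne_zero hb2 n
    have h₃ := hbn n
    have h₄ := hb2n n
    have h₅ : (n : ℝ) + 1 ≠ 0 := by positivity
    rw [ih] at h
    refine mul_left_cancel₀ (mul_ne_zero (mul_ne_zero h₅ h₃) h₄) (h.trans ?_)
    simp only [Nat.factorial_succ, ascPochhammer_succ_eval]
    push_cast
    generalize (ascPochhammer ℝ n).eval (2 * b - 1) = p at *
    generalize (ascPochhammer ℝ n).eval (b - 1 / 2) = q at *
    generalize 2 * b - 1 + (n : ℝ) = c at *
    field_simp
    ring
end

section
/- Let b be a nonzero complex number with Re(b) ≥ −1/2. Then for every natural number n, ∑_{k=0}^{n} 1/(k! · |(b)_k| · (n−k)! · |(b)_{n−k}|) ≤ 2^n / (n! · |b|^n). -/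
open Polynomial Finset

/-- If `Re b ≥ -1/2`, shifting `b` by a natural number does not decrease its modulus. -/
lemma norm_le_norm_add_natCast {b : ℂ} (hb : -(1 / 2 : ℝ) ≤ b.re) (j : ℕ) :
    ‖b‖ ≤ ‖b + j‖ := by
  rw [← sq_le_sq₀ (norm_nonneg _) (norm_nonneg _), Complex.sq_norm, Complex.sq_norm,
    Complex.normSq_apply, Complex.normSq_apply]
  simp only [Complex.add_re, Complex.add_im, Complex.natCast_re, Complex.natCast_im, add_zero]
  rcases Nat.eq_zero_or_pos j with rfl | hj
  · simp
  · have hj' : (1 : ℝ) ≤ j := by exact_mod_cast hj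
    nlinarith

/-- If `Re b ≥ -1/2`, then `|b|^k ≤ |(b)_k|`. -/
lemma norm_pow_le_norm_ascPochhammer_eval {b : ℂ} (hb : -(1 / 2 : ℝ) ≤ b.re) (k : ℕ) :
    ‖b‖ ^ k ≤ ‖(ascPochhammer ℂ k).eval b‖ := by
  induction k with
  | zero => simp
  | succ k ih =>
    rw [ascPochhammer_succ_eval, norm_mul, pow_succ]
    gcongr
    exact norm_le_norm_add_natCast hb k

/-- For a nonzero complex `b` with `Re(b) ≥ −1/2` and every natural `n`,
`∑_{k=0}^{n} 1/(k! |(b)_k| (n−k)! |(b)_{n−k}|) ≤ 2^n / (n! |b|^n)`. -/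
theorem pochhammer_abs_cauchy_bound (b : ℂ) (hb0 : b ≠ 0) (hb : -(1 / 2 : ℝ) ≤ b.re) (n : ℕ) :
    ∑ k ∈ Finset.range (n + 1),
        1 / ((k.factorial : ℝ) * ‖(ascPochhammer ℂ k).eval b‖ *
          ((n - k).factorial : ℝ) * ‖(ascPochhammer ℂ (n - k)).eval b‖) ≤
      2 ^ n / ((n.factorial : ℝ) * ‖b‖ ^ n) := by
  have hpos : 0 < ‖b‖ := norm_pos_iff.mpr hb0
  have hsum : ∑ k ∈ Finset.range (n + 1), (n.choose k : ℝ) = 2 ^ n := by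
    exact_mod_cast Nat.sum_range_choose n
  rw [← hsum, Finset.sum_div]
  refine Finset.sum_le_sum fun k hk => ?_
  have hkn : k ≤ n := Nat.lt_succ_iff.mp (Finset.mem_range.mp hk)
  calc 1 / ((k.factorial : ℝ) * ‖(ascPochhammer ℂ k).eval b‖ *
          ((n - k).factorial : ℝ) * ‖(ascPochhammer ℂ (n - k)).eval b‖)
      ≤ 1 / ((k.factorial : ℝ) * ‖b‖ ^ k * ((n - k).factorial : ℝ) * ‖b‖ ^ (n - k)) := by
        gcongr <;> exact norm_pow_le_norm_ascPochhammer_eval hb _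
    _ = (n.choose k : ℝ) / ((n.factorial : ℝ) * ‖b‖ ^ n) := by
        rw [Nat.cast_choose ℝ hkn, ← pow_mul_pow_sub ‖b‖ hkn]
        field_simp
end

section
/- The double series ∑_{n=1}^{∞} ∑_{k=0}^{n} 1/((4)_k · (4)_{n−k}) converges, its sum equals 4(56 − 45e + 9e²), and this value is strictly less than 1. -/
open Polynomial Finset

/-- The Pochhammer symbol `(4)_m` equals `(m + 3)! / 3!`. -/
lemma ascPochhammer_eval_four (m : ℕ) :
    (ascPochhammer ℝ m).eval 4 = ((m + 3).factorial : ℝ) / 6 := by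
  induction m with
  | zero => norm_num [Nat.factorial]
  | succ m ih =>
    rw [ascPochhammer_succ_eval, ih, show m + 1 + 3 = (m + 3) + 1 by ring,
      Nat.factorial_succ (m + 3)]
    push_cast
    ring

lemma hasSum_one_div_ascPochhammer_four :
    HasSum (fun m : ℕ => 1 / (ascPochhammer ℝ m).eval 4) (6 * Real.exp 1 - 15) := by
  have h : HasSum (fun n : ℕ => 1 / (n.factorial : ℝ)) (Real.exp 1) := by
    have := NormedSpace.expSeries_div_hasSum_exp (1 : ℝ)
    simpa [← Real.exp_eq_exp_ℝ] using this
  have h3 := ((hasSum_nat_add_iff' 3).mpr h).mul_left 6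
  have hv : 6 * (Real.exp 1 - ∑ i ∈ Finset.range 3, 1 / (i.factorial : ℝ)) =
      6 * Real.exp 1 - 15 := by
    norm_num [Finset.sum_range_succ, Nat.factorial]
    ring
  rw [hv] at h3
  simpa only [ascPochhammer_eval_four, one_div_div, mul_one_div] using h3

lemma hasSum_cauchyProduct_one_div_ascPochhammer_four :
    HasSum (fun n : ℕ => ∑ k ∈ Finset.range (n + 1),
        1 / ((ascPochhammer ℝ k).eval 4 * (ascPochhammer ℝ (n - k)).eval 4))
      ((6 * Real.exp 1 - 15) ^ 2) := by
  have h := hasSum_one_div_ascPochhammer_four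
  have hn := h.summable.norm
  have key := (summable_norm_sum_mul_range_of_summable_norm hn hn).of_norm.hasSum
  rw [← tsum_mul_tsum_eq_tsum_sum_range_of_summable_norm hn hn, h.tsum_eq, ← sq] at key
  simpa only [one_div_mul_one_div] using key

/-- The double series `∑_{n≥1} ∑_{k=0}^n 1/((4)_k (4)_{n−k})` converges, its sum equals
`4(56 − 45e + 9e²)`, and this value is strictly less than `1`. -/
theorem exp_example_sum :
    Summable (fun n : ℕ =>
      ∑ k ∈ Finset.range (n + 2),
        1 / ((ascPochhammer ℝ k).eval 4 * (ascPochhammer ℝ (n + 1 - k)).eval 4)) ∧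
    (∑' n : ℕ,
      ∑ k ∈ Finset.range (n + 2),
        1 / ((ascPochhammer ℝ k).eval 4 * (ascPochhammer ℝ (n + 1 - k)).eval 4)) =
      4 * (56 - 45 * Real.exp 1 + 9 * Real.exp 1 ^ 2) ∧
    4 * (56 - 45 * Real.exp 1 + 9 * Real.exp 1 ^ 2) < 1 := by
  have h := (hasSum_nat_add_iff' 1).mpr hasSum_cauchyProduct_one_div_ascPochhammer_four
  refine ⟨h.summable, h.tsum_eq.trans ?_, ?_⟩
  · simp only [Finset.sum_range_one, zero_add, Nat.sub_zero, ascPochhammer_zero, eval_one]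
    ring
  · nlinarith [Real.exp_one_gt_d9, Real.exp_one_lt_d9]
end

section
/- Let η be a nonzero complex number, let κ be a nonzero complex number with Re(κ) ≥ −1/2 and |κ| > |η|/(2 ln 2), and let c be a real number with 0 < c ≤ 1. Assume exp(21^(1/3)·|η|/(2^(5/3)·|κ|)) − c·exp(|η|/(2|κ|)) < 1. Then the generalized Bessel function F₃(z) = z + ∑_{n=1}^{∞} (−η)^n z^{n+1}/(4^n · n! · (κ)_n) satisfies: for every complex z with 0 < |z| < 1, F₃(z) ≠ 0 and |(z · F₃'(z) / F₃(z))² − 1| < c. -/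
open Polynomial

/-- The normalized generalized Bessel function with complex parameter `κ`:
`F₃(z) = z + ∑_{n≥1} (−η)^n z^{n+1}/(4^n n! (κ)_n)`. -/
noncomputable def F₃ (κ η : ℂ) (z : ℂ) : ℂ :=
  z + ∑' n : ℕ, (-η) ^ (n + 1) * z ^ (n + 2) /
    ((4 : ℂ) ^ (n + 1) * ((n + 1).factorial : ℂ) * (ascPochhammer ℂ (n + 1)).eval κ)

/-- For `D = 1 + s + ρ s² / 2 + σ s³ / 6 + T` with `ρ`, `σ` in the unit disk and small `T`, `U`, the
product `N` on the left satisfies `N / D² ≈ 2 + (2ρ - 1) s + (σ - ρ) s²`, and `‖N‖ ≤ 3.349 ‖D‖²`. -/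
lemma norm_jet_mul_le (s ρ σ T U : ℂ) (hs : ‖s‖ ≤ 0.2986) (hρ : ‖ρ‖ ≤ 1) (hσ : ‖σ‖ ≤ 1)
    (hσρ : ‖σ - ρ‖ ≤ 4 / 3) (hT : ‖T‖ ≤ 0.000353) (hU : ‖U‖ ≤ 0.0048) :
    0.652 ≤ ‖1 + s + ρ * s ^ 2 / 2 + σ * s ^ 3 / 6 + T‖ ∧
    ‖(1 + ρ * s + σ * s ^ 2 / 2 + U) *
        (2 + 3 * s + 2 * ρ * s ^ 2 + 5 / 6 * σ * s ^ 3 + (s * U + 2 * T))‖ ≤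
      3.349 * ‖1 + s + ρ * s ^ 2 / 2 + σ * s ^ 3 / 6 + T‖ ^ 2 := by
  have pw {a : ℂ} {M : ℝ} (n : ℕ) (h : ‖a‖ ≤ M) : ‖a ^ n‖ ≤ M ^ n := by
    rw [norm_pow]; exact pow_le_pow_left₀ (norm_nonneg _) h n
  have cst (x : ℝ) (hx : 0 ≤ x) : ‖(x : ℂ)‖ ≤ x := by simp [abs_of_nonneg hx]
  have ng {a : ℂ} {M : ℝ} (h : ‖a‖ ≤ M) : ‖-a‖ ≤ M := by rwa [norm_neg]
  have ml {a b : ℂ} {M N : ℝ} (h : ‖a‖ ≤ M) (k : ‖b‖ ≤ N) : ‖a * b‖ ≤ M * N :=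
    norm_mul_le_of_le h k
  have ad {a b : ℂ} {M N : ℝ} (h : ‖a‖ ≤ M) (k : ‖b‖ ≤ N) : ‖a + b‖ ≤ M + N :=
    norm_add_le_of_le h k
  have sc {a : ℂ} {M : ℝ} (x : ℝ) (hx : 0 ≤ x) (h : ‖a‖ ≤ M) : ‖(x : ℂ) * a‖ ≤ x * M :=
    ml (cst x hx) h
  set D := 1 + s + ρ * s ^ 2 / 2 + σ * s ^ 3 / 6 + T with hD
  have hD1 : ‖D - 1‖ ≤ 0.348 := by
    have e : D - 1 = s + ((1 / 2 : ℝ) : ℂ) * (ρ * s ^ 2)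
        + ((1 / 6 : ℝ) : ℂ) * (σ * s ^ 3) + T := by
      rw [hD]; push_cast; ring
    rw [e]
    refine (ad (ad (ad hs (sc _ (by norm_num) (ml hρ (pw 2 hs))))
      (sc _ (by norm_num) (ml hσ (pw 3 hs)))) hT).trans ?_
    norm_num
  have hDlow : 0.652 ≤ ‖D‖ := by
    have h1 : ‖(1 : ℂ)‖ ≤ ‖D‖ + ‖D - 1‖ := by
      simpa using norm_sub_le D (D - 1)
    rw [norm_one] at h1
    linarith
  have hQ1 : ‖2 * ρ - 1‖ ≤ 3 := by
    have e : 2 * ρ - 1 = ((2 : ℝ) : ℂ) * ρ + -((1 : ℝ) : ℂ) := by push_cast; ring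
    rw [e]
    exact (ad (sc 2 (by norm_num) hρ) (ng (cst 1 (by norm_num)))).trans (by norm_num)
  set Q := 2 + (2 * ρ - 1) * s + (σ - ρ) * s ^ 2 with hQdef
  have hQ : ‖Q‖ ≤ 3.0147 := by
    have e : Q = ((2 : ℝ) : ℂ) + (2 * ρ - 1) * s + (σ - ρ) * s ^ 2 := by
      rw [hQdef]; push_cast; ring
    rw [e]
    exact (ad (ad (cst 2 (by norm_num)) (ml hQ1 hs)) (ml hσρ (pw 2 hs))).trans (by norm_num)
  -- the Taylor remainder, sorted by powers of `s`
  set c3 : ℂ := ((1 : ℝ) : ℂ) + -ρ + -(((1 / 3 : ℝ) : ℂ) * σ) with hc3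
  set c4 : ℂ := ((1 / 6 : ℝ) : ℂ) * (ρ * σ) + -(((4 / 3 : ℝ) : ℂ) * σ)
    + -(((3 / 2 : ℝ) : ℂ) * ρ ^ 2) + ((2 : ℝ) : ℂ) * ρ with hc4
  set q3 : ℂ := ((1 / 3 : ℝ) : ℂ) * σ + ρ with hq3
  set q4 : ℂ := ((1 / 3 : ℝ) : ℂ) * σ + ((1 / 4 : ℝ) : ℂ) * ρ ^ 2 with hq4
  set c5 : ℂ := ((5 / 12 : ℝ) : ℂ) * σ ^ 2 + -(((1 / 3 : ℝ) : ℂ) * (ρ * σ))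
    + -((2 * ρ - 1) * q4) + -((σ - ρ) * q3) with hc5
  set c6 : ℂ := -(((1 / 18 : ℝ) : ℂ) * σ ^ 2) + -((2 * ρ - 1) * (((1 / 6 : ℝ) : ℂ) * (ρ * σ)))
    + -((σ - ρ) * q4) with hc6
  set c7 : ℂ := -((2 * ρ - 1) * (((1 / 36 : ℝ) : ℂ) * σ ^ 2))
    + -((σ - ρ) * (((1 / 6 : ℝ) : ℂ) * (ρ * σ))) with hc7
  set c8 : ℂ := -((σ - ρ) * (((1 / 36 : ℝ) : ℂ) * σ ^ 2)) with hc8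
  set A : ℂ := ((1 : ℝ) : ℂ) + ρ * s + ((1 / 2 : ℝ) : ℂ) * (σ * s ^ 2) with hA
  set V : ℂ := s * U + ((2 : ℝ) : ℂ) * T with hV
  set B : ℂ := ((2 : ℝ) : ℂ) + ((3 : ℝ) : ℂ) * s + ((2 : ℝ) : ℂ) * (ρ * s ^ 2)
    + ((5 / 6 : ℝ) : ℂ) * (σ * s ^ 3) + V with hB
  have b3 : ‖c3‖ ≤ 7 / 3 :=
    (ad (ad (cst 1 (by norm_num)) (ng hρ)) (ng (sc (1 / 3) (by norm_num) hσ))).trans (by norm_num)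
  have b4 : ‖c4‖ ≤ 5 :=
    (ad (ad (ad (sc (1 / 6) (by norm_num) (ml hρ hσ)) (ng (sc (4 / 3) (by norm_num) hσ)))
      (ng (sc (3 / 2) (by norm_num) (pw 2 hρ)))) (sc 2 (by norm_num) hρ)).trans (by norm_num)
  have bq3 : ‖q3‖ ≤ 4 / 3 := (ad (sc (1 / 3) (by norm_num) hσ) hρ).trans (by norm_num)
  have bq4 : ‖q4‖ ≤ 7 / 12 :=
    (ad (sc (1 / 3) (by norm_num) hσ) (sc (1 / 4) (by norm_num) (pw 2 hρ))).trans (by norm_num)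
  have b5 : ‖c5‖ ≤ 4.28 :=
    (ad (ad (ad (sc (5 / 12) (by norm_num) (pw 2 hσ)) (ng (sc (1 / 3) (by norm_num) (ml hρ hσ))))
      (ng (ml hQ1 bq4))) (ng (ml hσρ bq3))).trans (by norm_num)
  have b6 : ‖c6‖ ≤ 1.34 :=
    (ad (ad (ng (sc (1 / 18) (by norm_num) (pw 2 hσ)))
      (ng (ml hQ1 (sc (1 / 6) (by norm_num) (ml hρ hσ))))) (ng (ml hσρ bq4))).trans (by norm_num)
  have b7 : ‖c7‖ ≤ 0.31 :=
    (ad (ng (ml hQ1 (sc (1 / 36) (by norm_num) (pw 2 hσ))))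
      (ng (ml hσρ (sc (1 / 6) (by norm_num) (ml hρ hσ))))).trans (by norm_num)
  have b8 : ‖c8‖ ≤ 0.04 :=
    (ng (ml hσρ (sc (1 / 36) (by norm_num) (pw 2 hσ)))).trans (by norm_num)
  have bA : ‖A‖ ≤ 1.3432 :=
    (ad (ad (cst 1 (by norm_num)) (ml hρ hs))
      (sc (1 / 2) (by norm_num) (ml hσ (pw 2 hs)))).trans (by norm_num)
  have bV : ‖V‖ ≤ 0.00214 := (ad (ml hs hU) (sc 2 (by norm_num) hT)).trans (by norm_num)
  have bB : ‖B‖ ≤ 3.099 :=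
    (ad (ad (ad (ad (cst 2 (by norm_num)) (sc 3 (by norm_num) hs))
      (sc 2 (by norm_num) (ml hρ (pw 2 hs)))) (sc (5 / 6) (by norm_num) (ml hσ (pw 3 hs))))
      bV).trans (by norm_num)
  have bDT : ‖D + (D + -T)‖ ≤ 2.697 := by
    have e : D + (D + -T) = ((2 : ℝ) : ℂ) + ((2 : ℝ) : ℂ) * (D - 1) + -T := by push_cast; ring
    rw [e]
    exact (ad (ad (cst 2 (by norm_num)) (sc 2 (by norm_num) hD1)) (ng hT)).trans (by norm_num)
  have key : (1 + ρ * s + σ * s ^ 2 / 2 + U) *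
        (2 + 3 * s + 2 * ρ * s ^ 2 + 5 / 6 * σ * s ^ 3 + (s * U + 2 * T)) =
      D ^ 2 * Q + (s ^ 3 * c3 + s ^ 4 * c4 + s ^ 5 * c5 + s ^ 6 * c6 + s ^ 7 * c7 + s ^ 8 * c8
        + U * B + A * V + -((D + (D + -T)) * T * Q)) := by
    simp only [hD, hQdef, hc3, hc4, hc5, hc6, hc7, hc8, hq3, hq4, hA, hB, hV]
    push_cast
    ring
  refine ⟨hDlow, ?_⟩
  rw [key]
  have hE := ad (ad (ad (ad (ad (ad (ad (ad (ml (pw 3 hs) b3) (ml (pw 4 hs) b4))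
    (ml (pw 5 hs) b5)) (ml (pw 6 hs) b6)) (ml (pw 7 hs) b7)) (ml (pw 8 hs) b8)) (ml hU bB))
    (ml bA bV)) (ng (ml (ml bDT hT) hQ))
  refine (norm_add_le_of_le (ml (pw 2 le_rfl) hQ) hE).trans ?_
  have hsq : (0.652 : ℝ) ^ 2 ≤ ‖D‖ ^ 2 := pow_le_pow_left₀ (by norm_num) hDlow 2
  norm_num at hsq ⊢
  linarith

/-- The gap between the two exponentials in the hypothesis is at least linear. -/
lemma linear_lower_bound_of_exp_sub_mul_exp_lt {x c α : ℝ} (hx0 : 0 ≤ x) (hx : x ≤ 0.3466)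
    (hα : 0.869 ≤ α) (h : Real.exp (4 * α * x) - c * Real.exp (2 * x) < 1) : 3.349 * x < c := by
  have h1 : Real.exp (3.476 * x) ≤ Real.exp (4 * α * x) :=
    Real.exp_le_exp.2 (by nlinarith)
  have e1 : Real.exp (3.476 * x) = Real.exp (1.476 * x) * Real.exp (2 * x) := by
    rw [← Real.exp_add]; congr 1; ring
  have e2 : Real.exp (-(2 * x)) * Real.exp (2 * x) = 1 := by
    rw [← Real.exp_add]; simp
  have hp := Real.exp_pos (2 * x)
  have h2 : Real.exp (1.476 * x) - Real.exp (-(2 * x)) < c := by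
    have : (Real.exp (1.476 * x) - Real.exp (-(2 * x))) * Real.exp (2 * x)
        < c * Real.exp (2 * x) := by
      rw [sub_mul, ← e1, e2]; linarith
    exact lt_of_mul_lt_mul_right this hp.le
  have h3 : 1 + 1.476 * x + (1.476 * x) ^ 2 / 2 + (1.476 * x) ^ 3 / 6 ≤ Real.exp (1.476 * x) := by
    have := Real.sum_le_exp_of_nonneg (x := 1.476 * x) (by positivity) 4
    simp [Finset.sum_range_succ, Nat.factorial] at this
    linarith
  have h4 : Real.exp (-(2 * x)) ≤ 1 - 2 * x + 2 * x ^ 2 - 4 / 3 * x ^ 3 + 2 / 3 * x ^ 4 := by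
    have hb := Real.exp_bound (x := -(2 * x)) (n := 6)
      (by rw [abs_neg, abs_of_nonneg (by positivity)]; linarith) (by norm_num)
    have := (abs_le.1 hb).2
    rw [abs_neg, abs_of_nonneg (by positivity : 0 ≤ 2 * x)] at this
    simp [Finset.sum_range_succ, Nat.factorial] at this
    nlinarith [pow_nonneg hx0 5]
  have h5 : x ^ 4 ≤ 0.3466 * x ^ 3 := by nlinarith [pow_nonneg hx0 3]
  nlinarith [mul_nonneg hx0 (sq_nonneg (x - 0.278))]

/-- The Taylor coefficients of `F₃ κ η z / z`. -/
noncomputable def besselCoeff (κ η : ℂ) (n : ℕ) : ℂ :=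
  (-η) ^ n / ((4 : ℂ) ^ n * (n.factorial : ℂ) * (ascPochhammer ℂ n).eval κ)

lemma norm_le_norm_add_natCast_s15 {κ : ℂ} (hκ : -(1 / 2 : ℝ) ≤ κ.re) (n : ℕ) : ‖κ‖ ≤ ‖κ + n‖ := by
  rcases Nat.eq_zero_or_pos n with rfl | hn
  · simp
  have hn' : (1 : ℝ) ≤ n := by exact_mod_cast hn
  refine le_of_sq_le_sq ?_ (norm_nonneg _)
  rw [Complex.sq_norm, Complex.sq_norm, Complex.normSq_apply, Complex.normSq_apply]
  simp only [Complex.add_re, Complex.natCast_re, Complex.add_im, Complex.natCast_im, add_zero]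
  nlinarith

lemma norm_pow_le_norm_ascPochhammer {κ : ℂ} (hκ : -(1 / 2 : ℝ) ≤ κ.re) (n : ℕ) :
    ‖κ‖ ^ n ≤ ‖(ascPochhammer ℂ n).eval κ‖ := by
  induction n with
  | zero => simp
  | succ n ih =>
    rw [ascPochhammer_succ_eval, norm_mul, pow_succ]
    exact mul_le_mul ih (norm_le_norm_add_natCast_s15 hκ n) (norm_nonneg _) (norm_nonneg _)

lemma norm_besselCoeff_mul_pow_le {κ : ℂ} (hκ0 : κ ≠ 0) (hκ : -(1 / 2 : ℝ) ≤ κ.re) (η z : ℂ)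
    (n : ℕ) : ‖besselCoeff κ η n * z ^ n‖ ≤ (‖η‖ * ‖z‖ / (4 * ‖κ‖)) ^ n / n.factorial := by
  have hk : 0 < ‖κ‖ := norm_pos_iff.2 hκ0
  have hf : (0 : ℝ) < n.factorial := by exact_mod_cast n.factorial_pos
  have hP := norm_pow_le_norm_ascPochhammer hκ n
  rw [besselCoeff, norm_mul, norm_div, norm_mul, norm_mul, norm_pow, norm_pow, norm_pow, norm_neg,
    Complex.norm_natCast, Complex.norm_ofNat]
  calc ‖η‖ ^ n / (4 ^ n * n.factorial * ‖(ascPochhammer ℂ n).eval κ‖) * ‖z‖ ^ n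
      ≤ ‖η‖ ^ n / (4 ^ n * n.factorial * ‖κ‖ ^ n) * ‖z‖ ^ n := by gcongr
    _ = (‖η‖ * ‖z‖ / (4 * ‖κ‖)) ^ n / n.factorial := by
      rw [div_pow, mul_pow, mul_pow]; field_simp

lemma summable_natCast_mul_pow_div_factorial (y : ℝ) :
    Summable fun n : ℕ => (n : ℝ) * (y ^ n / n.factorial) := by
  rw [← summable_nat_add_iff 1]
  refine ((Real.summable_pow_div_factorial y).mul_left y).congr fun n => ?_
  rw [Nat.factorial_succ, Nat.cast_mul, pow_succ]
  have : ((n + 1 : ℕ) : ℝ) ≠ 0 := by positivity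
  field_simp

lemma summable_besselCoeff_mul_pow {κ : ℂ} (hκ0 : κ ≠ 0) (hκ : -(1 / 2 : ℝ) ≤ κ.re) (η z : ℂ) :
    Summable fun n => besselCoeff κ η n * z ^ n :=
  .of_norm_bounded (Real.summable_pow_div_factorial _) (norm_besselCoeff_mul_pow_le hκ0 hκ η z)

lemma norm_natCast_mul_besselCoeff_mul_pow_le {κ : ℂ} (hκ0 : κ ≠ 0) (hκ : -(1 / 2 : ℝ) ≤ κ.re)
    (η z : ℂ) (n : ℕ) : ‖(n : ℂ) * (besselCoeff κ η n * z ^ n)‖ ≤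
      n * ((‖η‖ * ‖z‖ / (4 * ‖κ‖)) ^ n / n.factorial) := by
  rw [norm_mul, Complex.norm_natCast]
  exact mul_le_mul_of_nonneg_left (norm_besselCoeff_mul_pow_le hκ0 hκ η z n) n.cast_nonneg

lemma summable_natCast_mul_besselCoeff_mul_pow {κ : ℂ} (hκ0 : κ ≠ 0)
    (hκ : -(1 / 2 : ℝ) ≤ κ.re) (η z : ℂ) :
    Summable fun n : ℕ => (n : ℂ) * (besselCoeff κ η n * z ^ n) :=
  .of_norm_bounded (summable_natCast_mul_pow_div_factorial _)
    (norm_natCast_mul_besselCoeff_mul_pow_le hκ0 hκ η z)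

lemma F₃_eq_mul_tsum {κ : ℂ} (hκ0 : κ ≠ 0) (hκ : -(1 / 2 : ℝ) ≤ κ.re) (η z : ℂ) :
    F₃ κ η z = z * ∑' n, besselCoeff κ η n * z ^ n := by
  rw [(summable_besselCoeff_mul_pow hκ0 hκ η z).tsum_eq_zero_add, mul_add, ← tsum_mul_left, F₃]
  congr 1
  · simp [besselCoeff]
  · refine tsum_congr fun n => ?_
    rw [besselCoeff]; ring

lemma hasDerivAt_F₃ {κ : ℂ} (hκ0 : κ ≠ 0) (hκ : -(1 / 2 : ℝ) ≤ κ.re) (η z : ℂ) :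
    HasDerivAt (F₃ κ η) ((∑' n, besselCoeff κ η n * z ^ n) +
      ∑' n : ℕ, (n : ℂ) * (besselCoeff κ η n * z ^ n)) z := by
  have hF : F₃ κ η = fun w => ∑' n, besselCoeff κ η n * w ^ (n + 1) := by
    funext w
    rw [F₃_eq_mul_tsum hκ0 hκ, ← tsum_mul_left]
    exact tsum_congr fun n => by ring
  rw [hF, ← (summable_besselCoeff_mul_pow hκ0 hκ η z).tsum_add
    (summable_natCast_mul_besselCoeff_mul_pow hκ0 hκ η z)]
  have hd := hasDerivAt_tsum_of_isPreconnected (𝕜 := ℂ) (y₀ := 0) (y := z)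
    (t := Metric.ball (0 : ℂ) (‖z‖ + 1))
    (g := fun n w => besselCoeff κ η n * w ^ (n + 1))
    (g' := fun n w => besselCoeff κ η n * w ^ n + (n : ℂ) * (besselCoeff κ η n * w ^ n))
    ((Real.summable_pow_div_factorial (‖η‖ * (‖z‖ + 1) / (4 * ‖κ‖))).add
      (summable_natCast_mul_pow_div_factorial (‖η‖ * (‖z‖ + 1) / (4 * ‖κ‖))))
    Metric.isOpen_ball (convex_ball _ _).isPreconnected
    (fun n w _ => by
      have h := (hasDerivAt_pow (n + 1) w).const_mul (besselCoeff κ η n)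
      refine h.congr_deriv ?_
      push_cast
      ring)
    (fun n w hw => by
      have hw' : ‖w‖ ≤ ‖z‖ + 1 := (mem_ball_zero_iff.1 hw).le
      refine norm_add_le_of_le ((norm_besselCoeff_mul_pow_le hκ0 hκ η w n).trans ?_)
        ((norm_natCast_mul_besselCoeff_mul_pow_le hκ0 hκ η w n).trans ?_) <;> gcongr)
    (Metric.mem_ball_self (by positivity)) (by simp)
    (mem_ball_zero_iff.2 (lt_add_one _))
  exact hd

lemma norm_tsum_nat_add_le_of_norm_le_pow_div_factorial {a : ℕ → ℂ} {r : ℝ} (m : ℕ) (hr0 : 0 ≤ r)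
    (hr : r < 1) (k : ℕ) (ha : ∀ n, ‖a n‖ ≤ r ^ (n + k) / (m + n).factorial) :
    ‖∑' n, a n‖ ≤ r ^ k / m.factorial * (1 - r / (m + 1))⁻¹ := by
  have hm : (0 : ℝ) < m + 1 := by positivity
  have hlt : r / (m + 1) < 1 := by
    rw [div_lt_one hm]; linarith [(Nat.cast_nonneg m : (0 : ℝ) ≤ m)]
  refine tsum_of_norm_bounded
    ((hasSum_geometric_of_lt_one (div_nonneg hr0 hm.le) hlt).mul_left _) fun n => (ha n).trans ?_
  have hf : (m.factorial : ℝ) * (m + 1) ^ n ≤ (m + n).factorial := by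
    exact_mod_cast Nat.factorial_mul_pow_le_factorial
  have hf0 : (0 : ℝ) < m.factorial := by exact_mod_cast m.factorial_pos
  calc r ^ (n + k) / (m + n).factorial ≤ r ^ (n + k) / (m.factorial * (m + 1) ^ n) := by gcongr
    _ = r ^ k / m.factorial * (r / (m + 1)) ^ n := by
      rw [div_pow, pow_add]; field_simp

lemma F₃_ne_zero_and_norm_sq_sub_one_le {κ : ℂ} (hκ0 : κ ≠ 0) (hκ : -(1 / 2 : ℝ) ≤ κ.re)
    {η z : ℂ} (hη : η ≠ 0) (hz : z ≠ 0) (hr : ‖η‖ * ‖z‖ / (4 * ‖κ‖) ≤ 0.2986) :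
    F₃ κ η z ≠ 0 ∧ ‖(z * deriv (F₃ κ η) z / F₃ κ η z) ^ 2 - 1‖ ≤
      3.349 * (‖η‖ * ‖z‖ / (4 * ‖κ‖)) := by
  rw [(hasDerivAt_F₃ hκ0 hκ η z).deriv, F₃_eq_mul_tsum hκ0 hκ]
  set r := ‖η‖ * ‖z‖ / (4 * ‖κ‖) with hrdef
  set a : ℕ → ℂ := fun n => besselCoeff κ η n * z ^ n with ha
  have hk : 0 < ‖κ‖ := norm_pos_iff.2 hκ0
  have hr0 : 0 < r := by
    have := norm_pos_iff.2 hη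
    have := norm_pos_iff.2 hz
    positivity
  have hκ1 : κ + 1 ≠ 0 := fun h => by
    have := congrArg Complex.re h
    simp at this
    linarith
  have hκ2 : κ + 2 ≠ 0 := fun h => by
    have := congrArg Complex.re h
    simp at this
    linarith
  have hn1 : ‖κ‖ ≤ ‖κ + 1‖ := by simpa using norm_le_norm_add_natCast_s15 hκ 1
  have hn2 : ‖κ‖ ≤ ‖κ + 2‖ := by simpa using norm_le_norm_add_natCast_s15 hκ 2
  set s : ℂ := -η * z / (4 * κ) with hs
  set ρ : ℂ := κ / (κ + 1) with hρ
  set σ : ℂ := ρ * (κ / (κ + 2)) with hσ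
  have hsr : ‖s‖ = r := by simp [hs, hrdef]
  have hs0 : s ≠ 0 := norm_pos_iff.1 (hsr ▸ hr0)
  have bρ : ‖ρ‖ ≤ 1 := by
    rw [hρ, norm_div]; exact div_le_one_of_le₀ hn1 (norm_nonneg _)
  have bσ : ‖σ‖ ≤ 1 := by
    rw [hσ, norm_mul, norm_div κ (κ + 2)]
    exact mul_le_one₀ bρ (by positivity) (div_le_one_of_le₀ hn2 (norm_nonneg _))
  have bσρ : ‖σ - ρ‖ ≤ 4 / 3 := by
    have e : σ - ρ = -(ρ * (2 / (κ + 2))) := by rw [hσ]; field_simp; ring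
    have h2 : 3 / 2 ≤ ‖κ + 2‖ := by
      have := Complex.re_le_norm (κ + 2)
      simp at this
      linarith
    rw [e, norm_neg, norm_mul, norm_div 2 (κ + 2), Complex.norm_ofNat]
    have h3 : 2 / ‖κ + 2‖ ≤ 4 / 3 := by
      rw [div_le_iff₀ (by linarith)]; linarith
    calc ‖ρ‖ * (2 / ‖κ + 2‖) ≤ 1 * (4 / 3) :=
          mul_le_mul bρ h3 (by positivity) zero_le_one
      _ = 4 / 3 := one_mul _
  have a0 : a 0 = 1 := by simp [ha, besselCoeff]
  have a1 : a 1 = s := by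
    simp [ha, besselCoeff, hs]; ring
  have a2 : a 2 = ρ * s ^ 2 / 2 := by
    simp [ha, besselCoeff, hs, hρ, ascPochhammer_succ_eval, Nat.factorial]
    field_simp
  have a3 : a 3 = σ * s ^ 3 / 6 := by
    simp [ha, besselCoeff, hs, hρ, hσ, ascPochhammer_succ_eval, Nat.factorial]
    field_simp
  set T := ∑' n, a (n + 4) with hT
  set V := ∑' n : ℕ, ((n + 4 : ℕ) : ℂ) * a (n + 4) with hV
  have hg : ∑' n, a n = 1 + s + ρ * s ^ 2 / 2 + σ * s ^ 3 / 6 + T := by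
    rw [← (summable_besselCoeff_mul_pow hκ0 hκ η z).sum_add_tsum_nat_add 4]
    simp only [Finset.sum_range_succ, Finset.sum_range_zero]
    rw [← a3, ← a2, ← a1, ← a0, zero_add]
  have hh : ∑' n : ℕ, (n : ℂ) * a n = s + ρ * s ^ 2 + σ * s ^ 3 / 2 + V := by
    rw [← (summable_natCast_mul_besselCoeff_mul_pow hκ0 hκ η z).sum_add_tsum_nat_add 4]
    change ∑ i ∈ Finset.range 4, (i : ℂ) * a i + V = _
    simp only [Finset.sum_range_succ, Finset.sum_range_zero, a1, a2, a3]
    push_cast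
    ring
  have bT : ‖T‖ ≤ 0.000353 := by
    refine (norm_tsum_nat_add_le_of_norm_le_pow_div_factorial 4 hr0.le (by linarith) 4
      fun n => ?_).trans ?_
    · rw [add_comm 4 n]
      exact norm_besselCoeff_mul_pow_le hκ0 hκ η z (n + 4)
    · calc r ^ 4 / (Nat.factorial 4 : ℝ) * (1 - r / ((4 : ℕ) + 1))⁻¹
          ≤ 0.2986 ^ 4 / (Nat.factorial 4 : ℝ) * (1 - 0.2986 / (((4 : ℕ) : ℝ) + 1))⁻¹ := by
            gcongr
            norm_num; linarith
        _ ≤ 0.000353 := by norm_num [Nat.factorial]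
  have bV : ‖V / s‖ ≤ 0.0048 := by
    have hb : ‖V‖ ≤ r ^ 4 / (Nat.factorial 3 : ℝ) * (1 - r / ((3 : ℕ) + 1))⁻¹ := by
      refine norm_tsum_nat_add_le_of_norm_le_pow_div_factorial 3 hr0.le (by linarith) 4 fun n => ?_
      refine (norm_natCast_mul_besselCoeff_mul_pow_le hκ0 hκ η z (n + 4)).trans_eq ?_
      rw [add_comm 3 n, Nat.factorial_succ (n + 3), Nat.cast_mul, ← hrdef]
      have : ((n + 3 + 1 : ℕ) : ℝ) ≠ 0 := by positivity
      field_simp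
    rw [norm_div, hsr, div_le_iff₀ hr0]
    refine hb.trans ?_
    calc r ^ 4 / (Nat.factorial 3 : ℝ) * (1 - r / ((3 : ℕ) + 1))⁻¹
        = r ^ 3 / (Nat.factorial 3 : ℝ) * (1 - r / ((3 : ℕ) + 1))⁻¹ * r := by ring
      _ ≤ 0.2986 ^ 3 / (Nat.factorial 3 : ℝ) * (1 - 0.2986 / (((3 : ℕ) : ℝ) + 1))⁻¹ * r := by
          gcongr
          norm_num; linarith
      _ ≤ 0.0048 * r := by
          refine mul_le_mul_of_nonneg_right ?_ hr0.le
          norm_num [Nat.factorial]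
  obtain ⟨hlow, hjet⟩ := norm_jet_mul_le s ρ σ T (V / s) (hsr.trans_le hr) bρ bσ bσρ bT bV
  rw [← hg] at hlow hjet
  set g := ∑' n, a n with hgdef
  have hg0 : g ≠ 0 := norm_pos_iff.1 (lt_of_lt_of_le (by norm_num) hlow)
  refine ⟨mul_ne_zero hz hg0, ?_⟩
  set N := (1 + ρ * s + σ * s ^ 2 / 2 + V / s) *
    (2 + 3 * s + 2 * ρ * s ^ 2 + 5 / 6 * σ * s ^ 3 + (s * (V / s) + 2 * T)) with hN
  have hfac : (∑' n : ℕ, (n : ℂ) * a n) * (2 * g + ∑' n : ℕ, (n : ℂ) * a n) = s * N := by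
    rw [hh, hg, hN]
    field_simp
    ring
  have e : (z * (g + ∑' n : ℕ, (n : ℂ) * a n) / (z * g)) ^ 2 - 1 = s * N / g ^ 2 := by
    rw [← hfac]
    field_simp
    ring
  rw [e, norm_div, norm_mul, hsr, norm_pow, div_le_iff₀ (by positivity)]
  calc r * ‖N‖ ≤ r * (3.349 * ‖g‖ ^ 2) := mul_le_mul_of_nonneg_left hjet hr0.le
    _ = 3.349 * r * ‖g‖ ^ 2 := by ring

/-- Lemniscate starlikeness of the generalized Bessel function with complex parameters:
if `η ≠ 0`, `κ ≠ 0`, `Re(κ) ≥ −1/2`, `|κ| > |η|/(2 ln 2)`, `0 < c ≤ 1`, and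
`exp(21^(1/3)|η|/(2^(5/3)|κ|)) − c exp(|η|/(2|κ|)) < 1`, then
`|(z F₃'(z)/F₃(z))² − 1| < c` for `0 < |z| < 1`. -/
theorem generalized_Bessel_complex_lemniscate_starlike (η κ : ℂ)
    (hη : η ≠ 0) (hκ0 : κ ≠ 0) (hκre : -(1 / 2 : ℝ) ≤ κ.re)
    (hκ : ‖η‖ / (2 * Real.log 2) < ‖κ‖)
    (c : ℝ) (hc0 : 0 < c) (hc1 : c ≤ 1)
    (h : Real.exp ((21 : ℝ) ^ ((1 : ℝ) / 3) * ‖η‖ /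
          ((2 : ℝ) ^ ((5 : ℝ) / 3) * ‖κ‖)) -
        c * Real.exp (‖η‖ / (2 * ‖κ‖)) < 1) :
    ∀ z : ℂ, 0 < ‖z‖ → ‖z‖ < 1 →
      F₃ κ η z ≠ 0 ∧ ‖(z * deriv (F₃ κ η) z / F₃ κ η z) ^ 2 - 1‖ < c := by
  intro z hz0 hz1
  have hk : 0 < ‖κ‖ := norm_pos_iff.2 hκ0
  set x := ‖η‖ / (4 * ‖κ‖) with hx
  have hx0 : 0 < x := by
    have := norm_pos_iff.2 hη
    positivity
  have hlog : x ≤ 0.3466 := by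
    have h2 : 0 < Real.log 2 := Real.log_pos (by norm_num)
    rw [div_lt_iff₀ (by positivity)] at hκ
    rw [hx, div_le_iff₀ (by positivity)]
    nlinarith [Real.log_two_lt_d9]
  have hα : (0.869 : ℝ) ≤ (21 : ℝ) ^ ((1 : ℝ) / 3) / (2 : ℝ) ^ ((5 : ℝ) / 3) := by
    have e : (21 : ℝ) ^ ((1 : ℝ) / 3) / (2 : ℝ) ^ ((5 : ℝ) / 3) = (21 / 32 : ℝ) ^ ((1 : ℝ) / 3) := by
      rw [Real.div_rpow (by norm_num) (by norm_num), show (32 : ℝ) = 2 ^ (5 : ℝ) by norm_num,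
        ← Real.rpow_mul (by norm_num)]
      norm_num
    rw [e]
    refine le_of_eq_of_le ?_ (Real.rpow_le_rpow (by norm_num)
      (by norm_num : (0.869 : ℝ) ^ (3 : ℝ) ≤ 21 / 32) (by norm_num : (0 : ℝ) ≤ 1 / 3))
    rw [← Real.rpow_mul (by norm_num)]
    norm_num
  have hcx : 3.349 * x < c := by
    refine linear_lower_bound_of_exp_sub_mul_exp_lt hx0.le hlog hα ?_
    convert h using 4
    · rw [hx]; field_simp
    · rw [hx]; field_simp; norm_num
  have hrx : ‖η‖ * ‖z‖ / (4 * ‖κ‖) = x * ‖z‖ := by rw [hx]; ring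
  have hle : x * ‖z‖ ≤ x := mul_le_of_le_one_right hx0.le hz1.le
  obtain ⟨h0, hb⟩ := F₃_ne_zero_and_norm_sq_sub_one_le hκ0 hκre hη (norm_pos_iff.1 hz0)
    (by rw [hrx]; linarith)
  refine ⟨h0, hb.trans_lt ?_⟩
  rw [hrx]
  linarith
end
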